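/- arXiv:1803.01448 — 5 statements merged into one kernel-verified Lean document; each statement's English description precedes it below -/
import Mathlib

section
/- Every derivation of McCarthy's 91-function has Horton–Strahler dimension at most 2: for all integers n, x and every natural number k, if M n x k holds then k ≤ 2. -/
/-- Horton–Strahler dimension of a root whose two subtrees have dimensions
`k1` and `k2`. -/
def dimc (k1 k2 : ℕ) : ℕ := if k1 = k2 then k1 + 1 else max k1 k2

/-- Dimension-instrumented derivation relation for McCarthy's 91-function. -/
inductive M : ℤ → ℤ → ℕ → Prop where
  | base (n : ℤ) : n > 100 → M n (n - 10) 0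
  | step (n y x : ℤ) (k1 k2 : ℕ) :
      n ≤ 100 → M (n + 11) y k1 → M y x k2 → M n x (dimc k1 k2)

/-- The result and the exact dimension of a derivation, as functions of the argument. -/
theorem M.value_and_dim {n x : ℤ} {k : ℕ} (h : M n x k) :
    (100 < n → x = n - 10 ∧ k = 0) ∧ (n ≤ 100 → x = 91) ∧
      (90 ≤ n → n ≤ 100 → k = 1) ∧ (n < 90 → k = 2) := by
  induction h with
  | base n hn => omega
  | step n y x k1 k2 hn _ _ ih1 ih2 =>
    unfold dimc
    split <;> omega

/-- Every derivation of McCarthy's 91-function has Horton–Strahler dimension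
at most 2. -/
theorem M_dim_le_two (n x : ℤ) (k : ℕ) : M n x k → k ≤ 2 := by
  intro h
  have := h.value_and_dim
  omega
end

section
/- The Horton–Strahler dimension of every Fibonacci derivation is at most half of the input: for all integers a, b and every natural number k, if F a b k holds then 2·(k : ℤ) − 1 < a (equivalently, 2·(k : ℤ) ≤ a). -/
/-- Dimension-instrumented Fibonacci derivation relation. -/
inductive F : ℤ → ℤ → ℕ → Prop where
  | base (n : ℤ) : 0 ≤ n → n ≤ 1 → F n n 0
  | step (n b1 b2 : ℤ) (k1 k2 : ℕ) :
      n > 1 → F (n - 2) b2 k1 → F (n - 1) b1 k2 → F n (b1 + b2) (dimc k1 k2)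

/-- The Horton–Strahler dimension of every Fibonacci derivation is at most half
of the input: if `F a b k` then `2 * k - 1 < a`. -/
theorem F_dim_le_half_input (a b : ℤ) (k : ℕ) : F a b k → 2 * (k : ℤ) - 1 < a := by
  intro h
  induction h with
  | base n h0 _ => push_cast; omega
  | step n b1 b2 k1 k2 _ _ _ ih1 ih2 =>
    unfold dimc
    split_ifs <;> push_cast <;> omega
end

section
/- In the counting-change program, the Horton–Strahler dimension of every derivation is at most the number of kinds of coins: for all integers x, y, z and every natural number k, if CC x y z k holds and 1 ≤ y, then (k : ℤ) ≤ y. -/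
/-- The kinds_of_coins facts: coin values for the 5 kinds of coins. -/
def coin (y : ℤ) : ℤ :=
  if y = 1 then 1 else if y = 2 then 5 else if y = 3 then 10
  else if y = 4 then 25 else if y = 5 then 50 else 0

/-- Dimension-instrumented counting-change derivation relation. -/
inductive CC : ℤ → ℤ → ℤ → ℕ → Prop where
  | b1 (y : ℤ) : y > 0 → CC 0 y 1 0
  | b2 (x y : ℤ) : x < 0 → CC x y 0 0
  | b3 (x y : ℤ) : y ≤ 0 → CC x y 0 0
  | step (x y z1 z2 : ℤ) (k1 k2 : ℕ) :
      x > 0 → 1 ≤ y → y ≤ 5 →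
      CC (x - coin y) y z1 k1 → CC x (y - 1) z2 k2 →
      CC x y (z1 + z2) (dimc k1 k2)

/-- The second subtree has smaller dimension bound, so the root keeps the bound of the first. -/
theorem dimc_le {k1 k2 n : ℕ} (h1 : k1 ≤ n) (h2 : k2 < n) : dimc k1 k2 ≤ n := by
  unfold dimc
  split_ifs <;> omega

/-- The dimension bound without the positivity assumption on the number of kinds of coins. -/
theorem CC.dim_le_toNat {x y z : ℤ} {k : ℕ} (h : CC x y z k) : k ≤ y.toNat := by
  induction h with
  | b1 | b2 | b3 => exact Nat.zero_le _
  | step x y z1 z2 k1 k2 _ hy _ _ _ ih1 ih2 => exact dimc_le ih1 (by omega)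

/-- In the counting-change program, the Horton–Strahler dimension of every
derivation is at most the number of kinds of coins. -/
theorem CC_dim_le_coins (x y z : ℤ) (k : ℕ) :
    CC x y z k → 1 ≤ y → (k : ℤ) ≤ y := by
  intro h hy
  have := h.dim_le_toNat
  omega
end

section
/- The Fib clause set is safe: for all integers a and b, if fib a b holds and a > 5, then b ≥ a (i.e., there is no derivation with a > 5 and b < a). -/
/-- Fibonacci derivation relation, encoding the clauses
`fib(A,B) :- A ≥ 0, A ≤ 1, B = A` and
`fib(A,B) :- A > 1, fib(A-2,B2), fib(A-1,B1), B = B1 + B2`. -/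
inductive fib : ℤ → ℤ → Prop where
  | base (n : ℤ) : 0 ≤ n → n ≤ 1 → fib n n
  | step (n b1 b2 : ℤ) :
      n > 1 → fib (n - 2) b2 → fib (n - 1) b1 → fib n (b1 + b2)

/-- Lower bounds for derivable values, strong enough to be inductive. -/
theorem fib.lower_bounds {a b : ℤ} (h : fib a b) :
    0 ≤ b ∧ a - 1 ≤ b ∧ (1 ≤ a → 1 ≤ b) ∧ (5 ≤ a → a ≤ b) := by
  induction h with
  | base n h0 h1 => omega
  | step n b1 b2 hn _ _ ih2 ih1 => omega

/-- The Fib clause set is safe: the integrity constraint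
`false :- A > 5, fib(A,B), B < A` is never derivable. -/
theorem fib_safe (a b : ℤ) : fib a b → a > 5 → b ≥ a := by
  intro h ha
  exact h.lower_bounds.2.2.2 (by omega)
end

section
/- The length-abstracted list-reverse program is safe with the invariant revlen(A,B) ← A = B ∧ B ≥ 0: for all integers a and b, if revlen a b holds then a = b and 0 ≤ b (in particular, the integrity constraint false :- revlen(A,B), A ≠ B is never derivable). -/
/-- Length abstraction of list append. -/
inductive applen : ℤ → ℤ → ℤ → Prop where
  | base (b : ℤ) : b ≥ 0 → applen 0 b b
  | step (a1 b c1 : ℤ) : applen a1 b c1 → applen (a1 + 1) b (c1 + 1)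

/-- Length abstraction of list reverse, encoding the clauses
`revlen(A,B) :- A = 0, B = 0` and
`revlen(A,B) :- revlen(A1,C), applen(C,D,B), A = A1 + 1, D = 1`. -/
inductive revlen : ℤ → ℤ → Prop where
  | base : revlen 0 0
  | step (a1 c b : ℤ) : revlen a1 c → applen c 1 b → revlen (a1 + 1) b

/-- The length of an append is the sum of the lengths. -/
theorem applen.add_eq {a b c : ℤ} (h : applen a b c) : a + b = c := by
  induction h with
  | base b _ => exact zero_add b
  | step a1 b c1 _ ih => omega

/-- The length-abstracted list-reverse program is safe with the invariant
`revlen(A,B) ← A = B ∧ B ≥ 0`; in particular the integrity constraint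
`false :- revlen(A,B), A ≠ B` is never derivable. -/
theorem revlen_safe (a b : ℤ) : revlen a b → a = b ∧ 0 ≤ b := by
  intro h
  induction h with
  | base => exact ⟨rfl, le_rfl⟩
  | step a1 c b _ happ ih =>
    have := happ.add_eq
    omega
end
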